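/- arXiv:1610.01499 — 2 statements merged into one kernel-verified Lean document; each statement's English description precedes it below -/
import Mathlib

section
/- Fix k ≥ 1 and k-periodic real sequences (a_n), (b_n), (c_n), (d_n) with c_n ≠ 0 and a_n d_n − b_n c_n ≠ 0 for all n. Assume T ≠ 0, Δ = T² − 4D > 0, and c̃_i ≠ 0 for all 0 ≤ i ≤ k−1. Let λ and μ be the two real roots of X² − T X + D, labeled so that |λ| > |μ|, and set ρ_i = (λ − d̃_i)/c̃_i. Then for every solution (x_n)_{n≥0} of the Riccati recurrence such that x_i ≠ (μ − d̃_i)/c̃_i for each 0 ≤ i ≤ k−1, one has lim_{n→∞} x_{nk+i} = ρ_i for each 0 ≤ i ≤ k−1; in particular, if ρ_0 = ρ_1 = ⋯ = ρ_{k−1} = ρ, then x_n → ρ as n → ∞. -/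
/-- The matrix `!![a n, b n; c n, d n]` of coefficients. -/
def matA (a b c d : ℕ → ℝ) (n : ℕ) : Matrix (Fin 2) (Fin 2) ℝ := !![a n, b n; c n, d n]

/-- `seg A i n = A (i+n-1) * ⋯ * A (i+1) * A i`, with `seg A i 0 = 1`. -/
def seg (A : ℕ → Matrix (Fin 2) (Fin 2) ℝ) (i : ℕ) : ℕ → Matrix (Fin 2) (Fin 2) ℝ
  | 0 => 1
  | n + 1 => A (i + n) * seg A i n

/-- `B_i = A_{i-1} ⋯ A_0 ⋅ A_{k-1} ⋯ A_i`. -/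
def matB (a b c d : ℕ → ℝ) (k i : ℕ) : Matrix (Fin 2) (Fin 2) ℝ :=
  seg (matA a b c d) 0 i * seg (matA a b c d) i (k - i)

/-- `(x_n)` is a solution of the Riccati recurrence `x_{n+1} = (a_n x_n + b_n)/(c_n x_n + d_n)`. -/
def IsRiccatiSol (a b c d : ℕ → ℝ) (x : ℕ → ℝ) : Prop :=
  ∀ n, c n * x n + d n ≠ 0 ∧ x (n + 1) = (a n * x n + b n) / (c n * x n + d n)

theorem seg_add (A : ℕ → Matrix (Fin 2) (Fin 2) ℝ) (i m n : ℕ) :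
    seg A i (m + n) = seg A (i + m) n * seg A i m := by
  induction n with
  | zero => simp [seg]
  | succ n ih =>
    rw [← add_assoc, seg, ih, seg, Matrix.mul_assoc, add_assoc]

theorem seg_shift (A : ℕ → Matrix (Fin 2) (Fin 2) ℝ) (k : ℕ) (hA : ∀ n, A (n + k) = A n)
    (i n : ℕ) : seg A (i + k) n = seg A i n := by
  induction n with
  | zero => simp [seg]
  | succ n ih =>
    rw [seg, seg, ih, add_right_comm, hA]

theorem seg_shift_mul (A : ℕ → Matrix (Fin 2) (Fin 2) ℝ) (k : ℕ) (hA : ∀ n, A (n + k) = A n)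
    (i n m : ℕ) : seg A (m * k + i) n = seg A i n := by
  induction m with
  | zero => simp
  | succ m ih =>
    rw [← ih, ← seg_shift A k hA (m * k + i)]
    congr 1
    ring

theorem seg_sol (a b c d x : ℕ → ℝ) (hx : IsRiccatiSol a b c d x) (i n : ℕ) :
    ∃ p : ℝ, p ≠ 0 ∧
      seg (matA a b c d) i n 0 0 * x i + seg (matA a b c d) i n 0 1 = p * x (i + n) ∧
      seg (matA a b c d) i n 1 0 * x i + seg (matA a b c d) i n 1 1 = p := by
  induction n with
  | zero => exact ⟨1, one_ne_zero, by simp [seg], by simp [seg]⟩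
  | succ n ih =>
    obtain ⟨p, hp, h0, h1⟩ := ih
    obtain ⟨hd, he⟩ := hx (i + n)
    refine ⟨p * (c (i + n) * x (i + n) + d (i + n)), mul_ne_zero hp hd, ?_, ?_⟩
    · rw [← add_assoc, he, mul_assoc, mul_div_cancel₀ _ hd]
      simp only [seg, matA, Matrix.mul_apply, Fin.sum_univ_two, Matrix.of_apply,
        Matrix.cons_val', Matrix.cons_val_zero, Matrix.cons_val_one, Matrix.cons_val_fin_one]
      linear_combination a (i + n) * h0 + b (i + n) * h1
    · simp only [seg, matA, Matrix.mul_apply, Fin.sum_univ_two, Matrix.of_apply,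
        Matrix.cons_val', Matrix.cons_val_zero, Matrix.cons_val_one, Matrix.cons_val_fin_one]
      linear_combination c (i + n) * h0 + d (i + n) * h1

open Filter in
theorem scalar_conv (al be ga de lam mu : ℝ) (hga : ga ≠ 0)
    (hs : lam + mu = al + de) (hp : lam * mu = al * de - be * ga) (habs : |mu| < |lam|)
    (y : ℕ → ℝ)
    (hy : ∀ n, ga * y n + de ≠ 0 ∧ al * y n + be = (ga * y n + de) * y (n + 1))
    (h0 : y 0 ≠ (mu - de) / ga) : Tendsto y atTop (nhds ((lam - de) / ga)) := by
  have hlam : lam ≠ 0 := by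
    rintro rfl
    simp at habs
    linarith [abs_nonneg mu]
  have hne : lam ≠ mu := by rintro rfl; exact lt_irrefl _ habs
  set ρ := (lam - de) / ga with hρ
  set σ := (mu - de) / ga with hσ
  have e1 : ρ * ga = lam - de := div_mul_cancel₀ _ hga
  have e2 : σ * ga = mu - de := div_mul_cancel₀ _ hga
  have hρσ : ρ - σ ≠ 0 := by
    intro h
    apply hne
    linear_combination ga * h - e1 + e2
  have f1 : be - ρ * de = - mu * ρ := by
    apply mul_right_cancel₀ hga
    linear_combination (mu - de) * e1 + hp - de * hs
  have f2 : be - σ * de = - lam * σ := by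
    apply mul_right_cancel₀ hga
    linear_combination (lam - de) * e2 + hp - de * hs
  have g1 : ∀ n, (ga * y n + de) * (y (n+1) - ρ) = mu * (y n - ρ) := by
    intro n
    linear_combination -(hy n).2 + f1 - y n * e1 - y n * hs
  have g2 : ∀ n, (ga * y n + de) * (y (n+1) - σ) = lam * (y n - σ) := by
    intro n
    linear_combination -(hy n).2 + f2 - y n * e2 - y n * hs
  have hn : ∀ n, y n - σ ≠ 0 := by
    intro n
    induction n with
    | zero => exact sub_ne_zero.2 h0
    | succ n ih =>
      intro h
      have := g2 n
      rw [h, mul_zero] at this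
      exact mul_ne_zero hlam ih this.symm
  have hr : ∀ n, (y n - ρ) / (y n - σ) = (mu / lam) ^ n * ((y 0 - ρ) / (y 0 - σ)) := by
    intro n
    induction n with
    | zero => simp
    | succ n ih =>
      rw [pow_succ', mul_assoc, ← ih, div_mul_div_comm, ← g1, ← g2, mul_div_mul_left _ _ (hy n).1]
  have hq : |mu / lam| < 1 := by
    rw [abs_div, div_lt_one (abs_pos.2 hlam)]
    exact habs
  have hlim : Tendsto (fun n => (y n - ρ) / (y n - σ)) atTop (nhds 0) := by
    rw [funext hr]
    simpa using (tendsto_pow_atTop_nhds_zero_of_abs_lt_one hq).mul_const ((y 0 - ρ) / (y 0 - σ))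
  have hform : ∀ n, y n = (ρ - σ * ((y n - ρ) / (y n - σ))) / (1 - (y n - ρ) / (y n - σ)) := by
    intro n
    have h1 : 1 - (y n - ρ) / (y n - σ) = (ρ - σ) / (y n - σ) := by
      have := hn n
      field_simp
      ring
    rw [h1, eq_div_iff (div_ne_zero hρσ (hn n))]
    have := hn n
    field_simp
    ring
  have hfin : Tendsto (fun n => (ρ - σ * ((y n - ρ) / (y n - σ))) / (1 - (y n - ρ) / (y n - σ)))
      atTop (nhds ((ρ - σ * 0) / (1 - 0))) :=
    ((hlim.const_mul σ).const_sub ρ).div (hlim.const_sub 1) (by norm_num)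
  rw [← funext hform] at hfin
  simpa using hfin

open Filter in
/-- `T ≠ 0`, `Δ > 0` case: convergence of the subsequences `x_{nk+i}` to
`ρ_i = (λ - d̃_i)/c̃_i`, and convergence to `ρ` when all the `ρ_i` coincide. -/
theorem stmt7 (k : ℕ) (hk : 1 ≤ k) (a b c d : ℕ → ℝ)
    (hper : ∀ n, a (n + k) = a n ∧ b (n + k) = b n ∧ c (n + k) = c n ∧ d (n + k) = d n)
    (hc : ∀ n, c n ≠ 0) (hdet : ∀ n, a n * d n - b n * c n ≠ 0)
    (hT : (matB a b c d k 0).trace ≠ 0)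
    (hΔ : (matB a b c d k 0).trace ^ 2 - 4 * (matB a b c d k 0).det > 0)
    (hctil : ∀ i < k, (matB a b c d k i) 1 0 ≠ 0)
    (lam mu : ℝ)
    (hlam : lam ^ 2 - (matB a b c d k 0).trace * lam + (matB a b c d k 0).det = 0)
    (hmu : mu ^ 2 - (matB a b c d k 0).trace * mu + (matB a b c d k 0).det = 0)
    (habs : |mu| < |lam|) :
    ∀ xs : ℕ → ℝ, IsRiccatiSol a b c d xs →
      (∀ i < k, xs i ≠ (mu - (matB a b c d k i) 1 1) / (matB a b c d k i) 1 0) →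
      (∀ i < k, Tendsto (fun n => xs (n * k + i)) atTop
        (nhds ((lam - (matB a b c d k i) 1 1) / (matB a b c d k i) 1 0))) ∧
      ∀ ρ : ℝ, (∀ i < k, (lam - (matB a b c d k i) 1 1) / (matB a b c d k i) 1 0 = ρ) →
        Tendsto xs atTop (nhds ρ) := by
  intro xs hx h0
  have hA : ∀ n, matA a b c d (n + k) = matA a b c d n := by
    intro n
    obtain ⟨h1, h2, h3, h4⟩ := hper n
    simp [matA, h1, h2, h3, h4]
  have hB : ∀ i < k, matB a b c d k i = seg (matA a b c d) i k := by
    intro i hi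
    have h := seg_add (matA a b c d) i (k - i) i
    rw [Nat.sub_add_cancel hi.le, Nat.add_sub_cancel' hi.le] at h
    have h' := seg_shift _ k hA 0 i
    rw [zero_add] at h'
    rw [matB, h, h']
  have hB0 : ∀ i < k, matB a b c d k 0 =
      seg (matA a b c d) i (k - i) * seg (matA a b c d) 0 i := by
    intro i hi
    have h := seg_add (matA a b c d) 0 i (k - i)
    rw [Nat.add_sub_cancel' hi.le, zero_add] at h
    rw [hB 0 hk, h]
  have hne : lam - mu ≠ 0 := by
    intro h
    rw [sub_eq_zero.1 h] at habs
    exact lt_irrefl _ habs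
  have hsum : lam + mu = (matB a b c d k 0).trace := by
    apply mul_left_cancel₀ hne
    linear_combination hlam - hmu
  have hprod : lam * mu = (matB a b c d k 0).det := by
    linear_combination lam * hsum - hlam
  have main : ∀ i < k, Tendsto (fun n => xs (n * k + i)) atTop
        (nhds ((lam - (matB a b c d k i) 1 1) / (matB a b c d k i) 1 0)) := by
    intro i hi
    apply scalar_conv (matB a b c d k i 0 0) (matB a b c d k i 0 1) _ _ lam mu (hctil i hi)
      _ _ habs
    · intro n
      obtain ⟨p, hp, e0, e1⟩ := seg_sol a b c d xs hx (n * k + i) k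
      rw [seg_shift_mul _ k hA, ← hB i hi] at e0 e1
      rw [e1, e0]
      refine ⟨hp, ?_⟩
      congr 2
      ring
    · simpa using h0 i hi
    · rw [hsum, hB0 i hi, Matrix.trace_mul_comm, ← matB, Matrix.trace_fin_two]
    · rw [hprod, hB0 i hi, Matrix.det_mul_comm, ← matB, Matrix.det_fin_two]
  refine ⟨main, fun ρ hρ => ?_⟩
  rw [tendsto_def]
  intro s hs
  have hev : ∀ᶠ n in atTop, ∀ i ∈ Finset.range k, xs (n * k + i) ∈ s := by
    rw [Filter.eventually_all_finset]
    intro i hi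
    have hi' := Finset.mem_range.1 hi
    have := main i hi'
    rw [hρ i hi'] at this
    exact this.eventually_mem hs
  have hev2 := (Nat.tendsto_div_const_atTop (Nat.one_le_iff_ne_zero.1 hk)).eventually hev
  filter_upwards [hev2] with m hm
  have := hm (m % k) (Finset.mem_range.2 (Nat.mod_lt _ hk))
  rw [Nat.div_add_mod'] at this
  exact this
end

section
/- Fix an integer k ≥ 1 and k-periodic real sequences (a_n), (c_n) with a_n c_n ≠ 0 for all n. Assume |ã| > 1 and c̃_i ≠ 0 for all 0 ≤ i ≤ k−1. Then: (a) the sequence (x̄_n) defined by x̄_{nk+i} = (ã − 1)/c̃_i for n ≥ 0 and 0 ≤ i ≤ k−1 is a k-periodic solution of x_{n+1} = a_n x_n/(c_n x_n + 1); and (b) every solution (x_n)_{n≥0} with x_0 ≠ 0 satisfies lim_{n→∞} x_{nk+i} = (ã − 1)/c̃_i for each 0 ≤ i ≤ k−1. -/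
/-- `(x_n)` is a solution of `x_{n+1} = a_n x_n / (c_n x_n + 1)`. -/
def IsSol (a c : ℕ → ℝ) (x : ℕ → ℝ) : Prop :=
  ∀ n, c n * x n + 1 ≠ 0 ∧ x (n + 1) = a n * x n / (c n * x n + 1)

/-- `ã = ∏_{j=0}^{k-1} a_j`. -/
def atil (a : ℕ → ℝ) (k : ℕ) : ℝ := ∏ j ∈ Finset.range k, a j

/-- `S_i = Σ_{j=0}^{i-1} c_j ∏_{r=0}^{j-1} a_r`. -/
def Ssum (a c : ℕ → ℝ) (i : ℕ) : ℝ :=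
  ∑ j ∈ Finset.range i, c j * ∏ r ∈ Finset.range j, a r

/-- `P_i = ∏_{j=0}^{i-1} a_j`. -/
def Pprod (a : ℕ → ℝ) (i : ℕ) : ℝ := ∏ j ∈ Finset.range i, a j

/-- `c̃_i = (∏_{j=i}^{k-1} a_j)·(Σ_{l=0}^{i-1} c_l ∏_{r=0}^{l-1} a_r)
    + Σ_{s=i}^{k-1} c_s ∏_{t=i}^{s-1} a_t`. -/
def ctil (a c : ℕ → ℝ) (k i : ℕ) : ℝ :=
  (∏ j ∈ Finset.Ico i k, a j) * (∑ l ∈ Finset.range i, c l * ∏ r ∈ Finset.range l, a r)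
    + ∑ s ∈ Finset.Ico i k, c s * ∏ t ∈ Finset.Ico i s, a t

lemma ctil_mul (a c : ℕ → ℝ) (k i : ℕ) (hi : i ≤ k) :
    Pprod a i * ctil a c k i = Ssum a c k + (Pprod a k - 1) * Ssum a c i := by
  have h1 : Pprod a i * (∏ j ∈ Finset.Ico i k, a j) = Pprod a k :=
    Finset.prod_range_mul_prod_Ico a hi
  have h2 : Ssum a c i + ∑ s ∈ Finset.Ico i k, c s * ∏ t ∈ Finset.range s, a t = Ssum a c k :=
    Finset.sum_range_add_sum_Ico _ hi
  have h3 : Pprod a i * ∑ s ∈ Finset.Ico i k, c s * ∏ t ∈ Finset.Ico i s, a t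
      = ∑ s ∈ Finset.Ico i k, c s * ∏ t ∈ Finset.range s, a t := by
    rw [Finset.mul_sum]
    apply Finset.sum_congr rfl
    intro s hs
    rw [← Finset.prod_range_mul_prod_Ico a (Finset.mem_Ico.1 hs).1]
    unfold Pprod
    ring
  have h4 : ctil a c k i = (∏ j ∈ Finset.Ico i k, a j) * Ssum a c i
    + ∑ s ∈ Finset.Ico i k, c s * ∏ t ∈ Finset.Ico i s, a t := rfl
  rw [h4, mul_add, h3, ← mul_assoc, h1, ← h2]
  ring

lemma Pprod_succ (a : ℕ → ℝ) (n : ℕ) : Pprod a (n + 1) = Pprod a n * a n :=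
  Finset.prod_range_succ _ _

lemma Ssum_succ (a c : ℕ → ℝ) (n : ℕ) : Ssum a c (n + 1) = Ssum a c n + c n * Pprod a n :=
  Finset.sum_range_succ _ _

open Filter in
/-- if `|ã| > 1` and all `c̃_i ≠ 0`: (a) `x̄_{nk+i} = (ã-1)/c̃_i` defines a
k-periodic solution; (b) every solution with `x₀ ≠ 0` satisfies
`x_{nk+i} → (ã-1)/c̃_i`. -/
theorem stmt15 (k : ℕ) (hk : 1 ≤ k) (a c : ℕ → ℝ)
    (hper : ∀ n, a (n + k) = a n ∧ c (n + k) = c n)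
    (hac : ∀ n, a n * c n ≠ 0) (hatil : 1 < |atil a k|)
    (hctil : ∀ i < k, ctil a c k i ≠ 0) :
    (∃ xbar : ℕ → ℝ, IsSol a c xbar ∧
      (∀ n, ∀ i < k, xbar (n * k + i) = (atil a k - 1) / ctil a c k i) ∧
      (∀ n, xbar (n + k) = xbar n)) ∧
    ∀ xs : ℕ → ℝ, IsSol a c xs → xs 0 ≠ 0 → ∀ i < k,
      Tendsto (fun n => xs (n * k + i)) atTop (nhds ((atil a k - 1) / ctil a c k i)) := by
  have ha : ∀ n, a n ≠ 0 := fun n => left_ne_zero_of_mul (hac n)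
  have hP : ∀ n, Pprod a n ≠ 0 := fun n => Finset.prod_ne_zero_iff.2 fun j _ => ha j
  have hA : atil a k = Pprod a k := rfl
  rw [hA] at hatil ⊢
  have hA0 := hP k
  have hA1 : Pprod a k - 1 ≠ 0 := by
    intro h
    rw [sub_eq_zero.1 h] at hatil
    simp at hatil
  have hPk : ∀ n, Pprod a (n + k) = Pprod a k * Pprod a n := by
    intro n
    induction n with
    | zero => simp [Pprod]
    | succ n ih =>
      rw [Nat.add_right_comm, Pprod_succ, ih, Pprod_succ, (hper n).1]; ring
  have hPn : ∀ n i, Pprod a (n * k + i) = Pprod a k ^ n * Pprod a i := by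
    intro n i
    induction n with
    | zero => simp
    | succ n ih =>
      rw [show (n + 1) * k + i = (n * k + i) + k by ring, hPk, ih]; ring
  obtain ⟨E, hE⟩ : ∃ E : ℕ → ℝ, ∀ n, E n =
    (Ssum a c k + (Pprod a k - 1) * Ssum a c n) / Pprod a n := ⟨_, fun _ => rfl⟩
  have hEc : ∀ i ≤ k, ctil a c k i = E i := by
    intro i hi
    rw [hE, eq_div_iff (hP i), ← ctil_mul a c k i hi, mul_comm]
  have hEs : ∀ n, a n * E (n + 1) = E n + (Pprod a k - 1) * c n := by
    intro n
    have := hP n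
    have := ha n
    rw [hE, hE, Pprod_succ, Ssum_succ]
    field_simp
    ring
  have hEp : ∀ n, E (n + k) = E n := by
    intro n
    induction n with
    | zero =>
      rw [zero_add, hE, hE]
      have h0 : Pprod a 0 = 1 := by simp [Pprod]
      have h1 : Ssum a c 0 = 0 := by simp [Ssum]
      rw [h0, h1]
      field_simp
      ring
    | succ n ih =>
      apply mul_left_cancel₀ (ha n)
      have h := hEs (n + k)
      rw [(hper n).1, (hper n).2, ih, ← hEs n] at h
      rw [Nat.add_right_comm, h]
  have hEn : ∀ n i, E (n * k + i) = E i := by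
    intro n i
    induction n with
    | zero => simp
    | succ n ih =>
      rw [show (n + 1) * k + i = (n * k + i) + k by ring, hEp, ih]
  have hE0 : ∀ n, E n ≠ 0 := by
    intro n
    have hlt := Nat.mod_lt n hk
    rw [← Nat.div_add_mod' n k, hEn, ← hEc _ hlt.le]
    exact hctil _ hlt
  refine ⟨⟨fun n => (Pprod a k - 1) / E n, ?_, ?_, ?_⟩, ?_⟩
  · intro n
    have h0 := hE0 n
    have h1 := hE0 (n + 1)
    have h2 := ha n
    have h3 : c n * ((Pprod a k - 1) / E n) + 1 = a n * E (n + 1) / E n := by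
      rw [hEs]
      field_simp
      ring
    refine ⟨?_, ?_⟩
    · simp only [h3]
      exact div_ne_zero (mul_ne_zero h2 h1) h0
    · simp only [h3]
      field_simp
  · intro n i hi
    simp only [hEn, hEc i hi.le]
  · intro n
    simp only [hEp]
  · intro xs hs hx0 i hi
    have hx : ∀ n, xs n ≠ 0 := by
      intro n
      induction n with
      | zero => exact hx0
      | succ n ih =>
        rw [(hs n).2]
        exact div_ne_zero (mul_ne_zero (ha n) ih) (hs n).1
    have hy : ∀ n, a n * (xs (n + 1))⁻¹ = (xs n)⁻¹ + c n := by
      intro n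
      have h1 := hx n
      have h2 := (hs n).1
      have h3 := ha n
      rw [(hs n).2]
      field_simp
      ring
    have hz : ∀ n, Pprod a n * ((Pprod a k - 1) * (xs n)⁻¹ - E n)
        = (Pprod a k - 1) * (xs 0)⁻¹ - E 0 := by
      intro n
      induction n with
      | zero => simp [Pprod]
      | succ n ih =>
        rw [← ih, Pprod_succ]
        linear_combination Pprod a n * (Pprod a k - 1) * hy n - Pprod a n * hEs n
    rw [hEc i hi.le]
    set Z := (Pprod a k - 1) * (xs 0)⁻¹ - E 0 with hZ
    have hinv : ∀ n, (xs (n * k + i))⁻¹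
        = (E i + (Pprod a k)⁻¹ ^ n * (Z / Pprod a i)) / (Pprod a k - 1) := by
      intro n
      have h := hz (n * k + i)
      rw [hPn, hEn] at h
      have h1 := hP i
      rw [← h, inv_pow]
      field_simp
      ring
    have hlim : Tendsto (fun n => (xs (n * k + i))⁻¹) atTop (nhds (E i / (Pprod a k - 1))) := by
      simp only [hinv]
      have h0 : Tendsto (fun n : ℕ => (Pprod a k)⁻¹ ^ n) atTop (nhds 0) := by
        apply tendsto_pow_atTop_nhds_zero_of_abs_lt_one
        rw [abs_inv]
        exact inv_lt_one_of_one_lt₀ hatil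
      have h1 := ((h0.mul_const (Z / Pprod a i)).const_add (E i)).div_const (Pprod a k - 1)
      simpa using h1
    have h2 := hlim.inv₀ (div_ne_zero (hE0 i) hA1)
    simpa using h2
end
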